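/- For each n there exists a function ψ: (0,∞) → (0,∞) with ψ(δ) → 0 as δ → 0, such that for every x ∈ ℒ_n, every δ > 0 and every finite collection Λ₁,…,Λ_ℓ ∈ Min_δ(x), the subgroup Λ₁ + ⋯ + Λ_ℓ belongs to Min_{ψ(δ)}(x). In particular, if dim_δ(x) = n then α(x) ≥ (1 + ψ(δ))^{−1}. -/

import Mathlib

open scoped BigOperators
open Matrix Topology Filter

noncomputable section

namespace SW

/-! ### Euclidean structure on `Fin n → ℝ` -/

/-- The standard Euclidean inner product on `Fin n → ℝ`. -/
def einner {n : ℕ} (v w : Fin n → ℝ) : ℝ := ∑ i, v i * w i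

/-- The Euclidean norm on `Fin n → ℝ`. -/
def enorm {n : ℕ} (v : Fin n → ℝ) : ℝ := Real.sqrt (∑ i, v i ^ 2)

lemma einner_add_left {n : ℕ} (u v w : Fin n → ℝ) :
    einner (u + v) w = einner u w + einner v w := by
  simp [einner, add_mul, Finset.sum_add_distrib]

lemma einner_neg_left {n : ℕ} (u w : Fin n → ℝ) : einner (-u) w = -einner u w := by
  simp [einner]

lemma einner_smul_left {n : ℕ} (c : ℝ) (u w : Fin n → ℝ) :
    einner (c • u) w = c * einner u w := by
  simp [einner, Finset.mul_sum, mul_assoc]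

/-! ### Covolume, rank, lattices, stability -/

/-- `√(det Gram)` of a finite family of vectors: the covolume of the ℤ-span of the family
(in the span of the family) when the family is linearly independent. -/
def gvol {n r : ℕ} (v : Fin r → (Fin n → ℝ)) : ℝ :=
  Real.sqrt (Matrix.det (Matrix.of fun i j => einner (v i) (v j)))

/-- `c` is the covolume of `Λ` in its real span, as computed from some ℤ-basis of `Λ` which is
linearly independent over `ℝ`. -/
def covolSpec {n : ℕ} (Λ : AddSubgroup (Fin n → ℝ)) (c : ℝ) : Prop :=
  ∃ (r : ℕ) (v : Fin r → (Fin n → ℝ)), LinearIndependent ℝ v ∧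
    Λ = AddSubgroup.closure (Set.range v) ∧ c = gvol v

/-- The covolume of a discrete subgroup `Λ ⊆ ℝⁿ` inside its real span (with `covol ⊥ = 1`). -/
def covol {n : ℕ} (Λ : AddSubgroup (Fin n → ℝ)) : ℝ := sInf {c | covolSpec Λ c}

/-- The rank of a discrete subgroup of `ℝⁿ`: the dimension of its real span. -/
def rk {n : ℕ} (Λ : AddSubgroup (Fin n → ℝ)) : ℕ :=
  Module.finrank ℝ (Submodule.span ℝ (Λ : Set (Fin n → ℝ)))

/-- A lattice in `ℝⁿ`: a discrete subgroup spanning `ℝⁿ` (equivalently, cocompact). -/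
def IsLattice {n : ℕ} (L : AddSubgroup (Fin n → ℝ)) : Prop :=
  DiscreteTopology ↥L ∧ Submodule.span ℝ (L : Set (Fin n → ℝ)) = ⊤

/-- A unimodular lattice: a lattice of covolume one. -/
def IsUnimodularLattice {n : ℕ} (L : AddSubgroup (Fin n → ℝ)) : Prop :=
  IsLattice L ∧ covol L = 1

/-- A stable lattice: a unimodular lattice all of whose subgroups have covolume at least one. -/
def IsStable {n : ℕ} (L : AddSubgroup (Fin n → ℝ)) : Prop :=
  IsUnimodularLattice L ∧ ∀ Λ : AddSubgroup (Fin n → ℝ), Λ ≤ L → 1 ≤ covol Λ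

/-! ### Matrices: the diagonal group `A`, `SL_n(ℤ)`, lattices from matrices -/

/-- The group `A` of positive diagonal matrices of determinant one (as a set of matrices). -/
def Apos (n : ℕ) : Set (Matrix (Fin n) (Fin n) ℝ) :=
  {a | ∃ d : Fin n → ℝ, (∀ i, 0 < d i) ∧ (∏ i, d i) = 1 ∧ a = Matrix.diagonal d}

/-- `SL_n(ℤ)` viewed as a set of real matrices. -/
def Gam (n : ℕ) : Set (Matrix (Fin n) (Fin n) ℝ) :=
  {γ | γ.det = 1 ∧ ∀ i j, ∃ m : ℤ, γ i j = (m : ℝ)}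

/-- The lattice `g·ℤⁿ` associated to a matrix `g`. -/
def latticeOf {n : ℕ} (g : Matrix (Fin n) (Fin n) ℝ) : AddSubgroup (Fin n → ℝ) :=
  AddSubgroup.closure (Set.range fun m : Fin n → ℤ => g.mulVec fun i => (m i : ℝ))

/-- The image `g·L` of a lattice under a matrix. -/
def mapLat {n : ℕ} (g : Matrix (Fin n) (Fin n) ℝ) (L : AddSubgroup (Fin n → ℝ)) :
    AddSubgroup (Fin n → ℝ) :=
  AddSubgroup.map (Matrix.mulVecLin g).toAddMonoidHom L

/-- The full preimage `A·g·Γ` in `SL_n(ℝ)` of the orbit `A·[g] ⊆ ℒ_n`; a point `[h] ∈ ℒ_n`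
lies in the closure of `A·[g]` iff `h ∈ closure (AOrbit g)`. -/
def AOrbit {n : ℕ} (g : Matrix (Fin n) (Fin n) ℝ) : Set (Matrix (Fin n) (Fin n) ℝ) :=
  {p | ∃ a ∈ Apos n, ∃ γ ∈ Gam n, p = a * g * γ}

/-- The orbit `A·[g] ⊆ ℒ_n` is bounded (has compact closure). -/
def HasBoundedAOrbit {n : ℕ} (g : Matrix (Fin n) (Fin n) ℝ) : Prop :=
  ∃ K : Set (Matrix (Fin n) (Fin n) ℝ), IsCompact K ∧
    ∀ a ∈ Apos n, ∃ γ ∈ Gam n, a * g * γ ∈ K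

/-! ### `α`, `Min_δ`, `V_δ`, `dim_δ` -/

/-- `α(x) = min { |Λ|^{1/r(Λ)} : Λ a nonzero subgroup of x }`. -/
def alpha {n : ℕ} (x : AddSubgroup (Fin n → ℝ)) : ℝ :=
  sInf {c | ∃ Λ : AddSubgroup (Fin n → ℝ), Λ ≤ x ∧ Λ ≠ ⊥ ∧ c = covol Λ ^ ((rk Λ : ℝ)⁻¹)}

/-- `α_k(x) = min { |Λ|^{1/k} : Λ a rank-`k` subgroup of x }`. -/
def alphak {n : ℕ} (k : ℕ) (x : AddSubgroup (Fin n → ℝ)) : ℝ :=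
  sInf {c | ∃ Λ : AddSubgroup (Fin n → ℝ), Λ ≤ x ∧ rk Λ = k ∧ c = covol Λ ^ ((k : ℝ)⁻¹)}

/-- `Min_δ(x)`: nonzero subgroups nearly attaining `α(x)`. -/
def MinSet {n : ℕ} (δ : ℝ) (x : AddSubgroup (Fin n → ℝ)) : Set (AddSubgroup (Fin n → ℝ)) :=
  {Λ | Λ ≤ x ∧ Λ ≠ ⊥ ∧ covol Λ ^ ((rk Λ : ℝ)⁻¹) < (1 + δ) * alpha x}

/-- `V_δ(x)`: the span of the subgroups in `Min_δ(x)`. -/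
def Vdelta {n : ℕ} (δ : ℝ) (x : AddSubgroup (Fin n → ℝ)) : Submodule ℝ (Fin n → ℝ) :=
  Submodule.span ℝ (⋃ Λ ∈ MinSet δ x, (Λ : Set (Fin n → ℝ)))

/-- `dim_δ(x) = dim V_δ(x)`. -/
def dimdelta {n : ℕ} (δ : ℝ) (x : AddSubgroup (Fin n → ℝ)) : ℕ :=
  Module.finrank ℝ (Vdelta δ x)

/-- `U_k^{x,ε} ⊆ A`: those `a` for which `δ ↦ dim_δ(ax)` equals `k` near `kε`. -/
def Uset {n : ℕ} (x : AddSubgroup (Fin n → ℝ)) (ε : ℝ) (k : ℕ) :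
    Set (Matrix (Fin n) (Fin n) ℝ) :=
  {a | a ∈ Apos n ∧ ∃ s ∈ 𝓝 ((k : ℝ) * ε), ∀ δ ∈ s, dimdelta δ (mapLat a x) = k}

/-- Logarithmic coordinates on the diagonal group. -/
def logCoord {n : ℕ} (a : Matrix (Fin n) (Fin n) ℝ) : Fin n → ℝ := fun i => Real.log (a i i)

/-! ### Covering radius -/

/-- The covering radius `covrad(L) = sup_u inf_{v ∈ L} ‖u - v‖`. -/
def covrad {n : ℕ} (L : AddSubgroup (Fin n → ℝ)) : ℝ :=
  ⨆ u : Fin n → ℝ, ⨅ v : L, enorm (u - (v : Fin n → ℝ))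

/-- `[g]` is a local maximum of `covrad : ℒ_d → ℝ` (phrased via the open quotient
`SL_d(ℝ) → ℒ_d`). -/
def IsLocalMaxCovrad {d : ℕ} (g : Matrix (Fin d) (Fin d) ℝ) : Prop :=
  ∃ W ∈ 𝓝 g, ∀ g' ∈ W, Matrix.det g' = 1 → covrad (latticeOf g') ≤ covrad (latticeOf g)

/-! ### Block upper triangular form -/

/-- Offset of the `i`-th diagonal block. -/
def off {k : ℕ} (ns : Fin k → ℕ) (i : Fin k) : ℕ :=
  ∑ j ∈ Finset.univ.filter (fun j => j < i), ns j

lemma off_add_lt {k : ℕ} (ns : Fin k → ℕ) (i : Fin k) (a : Fin (ns i)) :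
    off ns i + (a : ℕ) < ∑ j, ns j := by
  unfold off
  have hins : i ∉ Finset.univ.filter (fun j => j < i) := by simp
  have h2 : ∑ j ∈ insert i (Finset.univ.filter (fun j => j < i)), ns j ≤ ∑ j, ns j :=
    Finset.sum_le_sum_of_subset (Finset.subset_univ _)
  rw [Finset.sum_insert hins] at h2
  have := a.isLt
  omega

/-- The position, in `Fin n`, of the `a`-th coordinate of the `i`-th block. -/
def blockEmb {n k : ℕ} (ns : Fin k → ℕ) (hsum : (∑ j, ns j) = n) (i : Fin k)
    (a : Fin (ns i)) : Fin n :=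
  ⟨off ns i + (a : ℕ), hsum ▸ off_add_lt ns i a⟩

/-- `g` is block upper triangular with diagonal blocks `G i` (block sizes `ns`). -/
def IsBlockUT {n k : ℕ} (ns : Fin k → ℕ) (hsum : (∑ j, ns j) = n)
    (g : Matrix (Fin n) (Fin n) ℝ) (G : ∀ i, Matrix (Fin (ns i)) (Fin (ns i)) ℝ) : Prop :=
  (∀ (i : Fin k) (a b : Fin (ns i)),
      g (blockEmb ns hsum i a) (blockEmb ns hsum i b) = G i a b) ∧
  (∀ (i j : Fin k) (a : Fin (ns i)) (b : Fin (ns j)), j < i →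
      g (blockEmb ns hsum i a) (blockEmb ns hsum j b) = 0)

/-! ### Mordell constant -/

/-- The symmetric box `[-a₁,a₁] × ⋯ × [-aₙ,aₙ]` is admissible for `L`: its interior contains
no nonzero point of `L`. -/
def IsAdmissibleBox {n : ℕ} (L : AddSubgroup (Fin n → ℝ)) (a : Fin n → ℝ) : Prop :=
  (∀ i, 0 < a i) ∧ ∀ v ∈ L, v ≠ 0 → ∃ i, a i ≤ |v i|

/-- The Mordell constant `κ(L) = 2⁻ⁿ sup { Vol(B) : B admissible symmetric box for L }`. -/
def mordellConst {n : ℕ} (L : AddSubgroup (Fin n → ℝ)) : ℝ :=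
  (1 / 2 ^ n) * sSup {V | ∃ a : Fin n → ℝ, IsAdmissibleBox L a ∧ V = ∏ i, 2 * a i}

/-! ### Hermite constant -/

/-- Length of a shortest nonzero vector of `L`. -/
def shortest {m : ℕ} (L : AddSubgroup (Fin m → ℝ)) : ℝ :=
  sInf {t | ∃ w ∈ L, w ≠ 0 ∧ t = enorm w}

/-- The Hermite constant `γ_m`. -/
def hermiteConst (m : ℕ) : ℝ :=
  sSup {c | ∃ L : AddSubgroup (Fin m → ℝ), IsUnimodularLattice L ∧ c = shortest L ^ 2}

/-! ### Korkine–Zolotarev reduction -/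

/-- `v 0, …, v (n-1)` is a Korkine–Zolotarev reduced basis of `x`: it is a ℤ-basis, and for
each `i` the orthogonal projection of `v i` onto `span(v 0, …, v (i-1))^⊥` is shortest among the
nonzero such projections of vectors of `x` (projection lengths are expressed through Gram
determinants: the projection of `w` has length `gvol (v 0, …, v (i-1), w) / gvol (v 0, …, v (i-1))`). -/
def IsKZBasis {n : ℕ} (x : AddSubgroup (Fin n → ℝ)) (v : ℕ → (Fin n → ℝ)) : Prop :=
  LinearIndependent ℝ (fun j : Fin n => v (j : ℕ)) ∧
  x = AddSubgroup.closure (v '' Set.Iio n) ∧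
  ∀ i < n, ∀ w ∈ x, w ∉ Submodule.span ℝ (v '' Set.Iio i) →
    gvol (Fin.snoc (fun j : Fin i => v (j : ℕ)) (v i)) ≤
      gvol (Fin.snoc (fun j : Fin i => v (j : ℕ)) w)

/-- `A 0, …, A (n-1)` are the diagonal Korkine–Zolotarev coefficients of `x`: the lengths of
the successive orthogonal projections in a KZ reduced basis, i.e.
`A i = gvol (v 0, …, v i) / gvol (v 0, …, v (i-1))`. -/
def HasKZCoeffs {n : ℕ} (x : AddSubgroup (Fin n → ℝ)) (A : ℕ → ℝ) : Prop :=
  ∃ v : ℕ → (Fin n → ℝ), IsKZBasis x v ∧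
    ∀ i < n, A i * gvol (fun j : Fin i => v (j : ℕ)) = gvol (fun j : Fin (i + 1) => v (j : ℕ))

/-! ### Orthogonal complements and projections of lattices -/

/-- The orthogonal complement of a subspace `V ⊆ ℝⁿ`. -/
def orthoC {n : ℕ} (V : Submodule ℝ (Fin n → ℝ)) : Submodule ℝ (Fin n → ℝ) where
  carrier := {w | ∀ v ∈ V, einner w v = 0}
  zero_mem' := by intro v hv; simp [einner]
  add_mem' := by intro a b ha hb v hv; rw [einner_add_left, ha v hv, hb v hv, add_zero]
  smul_mem' := by intro c w hw v hv; rw [einner_smul_left, hw v hv, mul_zero]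

/-- The image `π(x)` of `x` under the orthogonal projection `π : ℝⁿ → V^⊥`:
`p = π(u)` iff `p ⊥ V` and `u - p ∈ V`. -/
def projLat {n : ℕ} (V : Submodule ℝ (Fin n → ℝ)) (x : AddSubgroup (Fin n → ℝ)) :
    AddSubgroup (Fin n → ℝ) where
  carrier := {p | (∀ v ∈ V, einner p v = 0) ∧ ∃ u ∈ x, u - p ∈ V}
  zero_mem' := ⟨by intro v hv; simp [einner], 0, x.zero_mem, by rw [sub_zero]; exact V.zero_mem⟩
  add_mem' := by
    rintro p q ⟨hp1, u1, hu1, hp2⟩ ⟨hq1, u2, hu2, hq2⟩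
    refine ⟨fun v hv => by rw [einner_add_left, hp1 v hv, hq1 v hv, add_zero],
      u1 + u2, x.add_mem hu1 hu2, ?_⟩
    have h : u1 + u2 - (p + q) = u1 - p + (u2 - q) := by abel
    rw [h]; exact V.add_mem hp2 hq2
  neg_mem' := by
    rintro p ⟨hp1, u, hu, hp2⟩
    refine ⟨fun v hv => by rw [einner_neg_left, hp1 v hv, neg_zero],
      -u, x.neg_mem hu, ?_⟩
    have h : -u - -p = -(u - p) := by abel
    rw [h]; exact V.neg_mem hp2

end SW

namespace SW

theorem one_le_det_one_add {ι : Type*} [Fintype ι] [DecidableEq ι] {C : Matrix ι ι ℝ}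
    (hC : C.PosSemidef) : 1 ≤ (1 + C).det := by
  have h := hC.1.charpoly_eq
  apply_fun Polynomial.eval (-1) at h
  rw [Matrix.eval_charpoly, Polynomial.eval_prod] at h
  have h1 : Matrix.scalar ι (-1 : ℝ) - C = -(1 + C) := by
    ext i j; simp [Matrix.one_apply, Matrix.diagonal_apply]; split_ifs <;> ring
  have h2 : ∏ i, Polynomial.eval (-1) (Polynomial.X - Polynomial.C (hC.1.eigenvalues i : ℝ))
      = (-1) ^ Fintype.card ι * ∏ i, (1 + hC.1.eigenvalues i) := by
    rw [← Finset.card_univ, ← Finset.prod_const, ← Finset.prod_mul_distrib]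
    refine Finset.prod_congr rfl fun i _ ↦ ?_
    simp; ring
  rw [h1, Matrix.det_neg] at h
  have h3 := mul_left_cancel₀ (pow_ne_zero _ (by norm_num)) (h.trans h2)
  rw [h3]
  exact Finset.one_le_prod fun i _ ↦ by linarith [hC.eigenvalues_nonneg i]

open scoped MatrixOrder ComplexOrder in
theorem det_le_det_add {ι : Type*} [Fintype ι] [DecidableEq ι] {A B : Matrix ι ι ℝ}
    (hA : A.PosSemidef) (hB : B.PosSemidef) : A.det ≤ (A + B).det := by
  by_cases h : A.det = 0
  · rw [h]; exact (hA.add hB).det_nonneg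
  obtain ⟨S, hS⟩ := CStarAlgebra.nonneg_iff_eq_star_mul_self.mp hA.nonneg
  rw [Matrix.star_eq_conjTranspose] at hS
  have hdet : A.det = S.det * S.det := by rw [hS, Matrix.det_mul, Matrix.det_conjTranspose]; simp
  have hSd : IsUnit S.det := by
    rw [isUnit_iff_ne_zero]; intro h0; exact h (by rw [hdet, h0, zero_mul])
  have h1 := Matrix.mul_nonsing_inv S hSd
  have h2 := Matrix.nonsing_inv_mul S hSd
  have key : A + B = Sᴴ * (1 + (S⁻¹)ᴴ * B * S⁻¹) * S := by
    have h3 : Sᴴ * (S⁻¹)ᴴ = 1 := by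
      rw [← Matrix.conjTranspose_mul, h2, Matrix.conjTranspose_one]
    rw [Matrix.mul_add, Matrix.add_mul, Matrix.mul_one, ← hS]
    congr 1
    calc B = (Sᴴ * (S⁻¹)ᴴ) * B * (S⁻¹ * S) := by rw [h3, h2]; simp
      _ = _ := by simp only [Matrix.mul_assoc]
  rw [key, Matrix.det_mul, Matrix.det_mul, Matrix.det_conjTranspose, hdet]
  have := one_le_det_one_add (hB.conjTranspose_mul_mul_same S⁻¹)
  simp only [star_trivial]
  nlinarith [mul_self_nonneg S.det]

section gram

variable {E : Type*} [NormedAddCommGroup E] [InnerProductSpace ℝ E]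

theorem gram_sum_smul {ι κ : Type*} [Fintype ι] [Fintype κ] (v : ι → E) (w : κ → E)
    (A : Matrix κ ι ℝ) (h : ∀ k, w k = ∑ i, A k i • v i) :
    Matrix.gram ℝ w = A * Matrix.gram ℝ v * Aᵀ := by
  ext a b
  simp only [Matrix.gram_apply, h, sum_inner, inner_sum, real_inner_smul_left,
    real_inner_smul_right, Matrix.mul_apply, Matrix.transpose_apply, Finset.sum_mul]
  refine Finset.sum_congr rfl fun i _ ↦ Finset.sum_congr rfl fun j _ ↦ ?_
  rw [real_inner_comm]; ring

variable [FiniteDimensional ℝ E] {ι κ : Type*} [Fintype ι] [Fintype κ] [DecidableEq ι]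
  [DecidableEq κ]

theorem det_gram_sumElim (v : ι → E) (q : κ → E) :
    (Matrix.gram ℝ (Sum.elim v q)).det = (Matrix.gram ℝ v).det *
      (Matrix.gram ℝ fun k ↦ (Submodule.span ℝ (Set.range v))ᗮ.starProjection (q k)).det := by
  set U := Submodule.span ℝ (Set.range v) with hU
  have hC : ∀ k, ∃ c : ι → ℝ, ∑ i, c i • v i = U.starProjection (q k) := fun k ↦ by
    rw [← Submodule.mem_span_range_iff_exists_fun]
    exact U.starProjection_apply_mem (q k)
  choose C hC using hC
  have h := gram_sum_smul (Sum.elim v fun k ↦ Uᗮ.starProjection (q k)) (Sum.elim v q)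
    (Matrix.fromBlocks 1 0 (Matrix.of C) 1) (by
      rintro (i | k)
      · simp [Matrix.one_apply]
      · simp [Matrix.one_apply, hC])
  have h2 : Matrix.gram ℝ (Sum.elim v fun k ↦ Uᗮ.starProjection (q k)) =
      Matrix.fromBlocks (Matrix.gram ℝ v) 0 0
        (Matrix.gram ℝ fun k ↦ Uᗮ.starProjection (q k)) := by
    have hp : ∀ i k, inner ℝ (v i) (Uᗮ.starProjection (q k)) = 0 := fun i k ↦
      (Uᗮ.starProjection_apply_mem (q k)) (v i) (Submodule.subset_span ⟨i, rfl⟩)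
    ext (i | k) (j | l)
    · simp
    · simpa using hp i l
    · simpa [real_inner_comm] using hp j k
    · simp
  rw [h, h2, Matrix.det_mul, Matrix.det_mul, Matrix.det_transpose,
    Matrix.det_fromBlocks_zero₁₂, Matrix.det_fromBlocks_zero₁₂]
  simp

theorem det_gram_starProjection_le (U : Submodule ℝ E) (q : κ → E) :
    (Matrix.gram ℝ fun k ↦ U.starProjection (q k)).det ≤ (Matrix.gram ℝ q).det := by
  have : Matrix.gram ℝ q = (Matrix.gram ℝ fun k ↦ U.starProjection (q k)) +
      Matrix.gram ℝ fun k ↦ Uᗮ.starProjection (q k) := by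
    ext a b
    have ha := U.starProjection_add_starProjection_orthogonal (q a)
    have hb := U.starProjection_add_starProjection_orthogonal (q b)
    have h1 := (Uᗮ.starProjection_apply_mem (q a)) _ (U.starProjection_apply_mem (q b))
    have h2 := (Uᗮ.starProjection_apply_mem (q b)) _ (U.starProjection_apply_mem (q a))
    simp only [Matrix.gram_apply, Matrix.add_apply]
    conv_lhs => rw [← ha, ← hb]
    rw [inner_add_left, inner_add_right, inner_add_right, h2,
      real_inner_comm _ (Uᗮ.starProjection (q a)), h1]
    ring
  rw [this]
  exact det_le_det_add (Matrix.posSemidef_gram ℝ _) (Matrix.posSemidef_gram ℝ _)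

theorem det_gram_sumElim_mul_le {ι' : Type*} [Fintype ι'] [DecidableEq ι'] (u : ι' → E)
    (v : ι → E) (q : κ → E) (huv : ∀ i, u i ∈ Submodule.span ℝ (Set.range v)) :
    (Matrix.gram ℝ (Sum.elim v q)).det * (Matrix.gram ℝ u).det ≤
      (Matrix.gram ℝ v).det * (Matrix.gram ℝ (Sum.elim u q)).det := by
  rw [det_gram_sumElim, det_gram_sumElim]
  set V := Submodule.span ℝ (Set.range v)
  set U := Submodule.span ℝ (Set.range u)
  have hUV : U ≤ V := Submodule.span_le.mpr (by rintro _ ⟨i, rfl⟩; exact huv i)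
  have hP : ∀ k, Vᗮ.starProjection (q k) = Vᗮ.starProjection (Uᗮ.starProjection (q k)) := by
    intro k
    rw [← U.starProjection_add_starProjection_orthogonal (q k), map_add]
    have : Vᗮ.starProjection (U.starProjection (q k)) = 0 := by
      rw [Submodule.starProjection_apply_eq_zero_iff]
      rw [Submodule.orthogonal_orthogonal]
      exact hUV (U.starProjection_apply_mem _)
    rw [this]; simp
  have h := det_gram_starProjection_le Vᗮ fun k ↦ Uᗮ.starProjection (q k)
  simp_rw [← hP] at h
  have h1 := (Matrix.posSemidef_gram ℝ u).det_nonneg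
  have h2 := (Matrix.posSemidef_gram ℝ v).det_nonneg
  nlinarith [mul_le_mul_of_nonneg_left h (mul_nonneg h1 h2)]

end gram

/-- The covolume of a finite family of vectors, over an arbitrary index type. -/
def vol {n : ℕ} {ι : Type*} [Fintype ι] [DecidableEq ι] (v : ι → Fin n → ℝ) : ℝ :=
  Real.sqrt (Matrix.gram ℝ fun i ↦ WithLp.toLp 2 (v i)).det

theorem gvol_eq_vol {n r : ℕ} (v : Fin r → Fin n → ℝ) : gvol v = vol v := by
  unfold gvol vol
  congr 2
  ext i j
  simp [Matrix.gram_apply, einner, PiLp.inner_apply, mul_comm]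

/-- `v` is a `ℤ`-basis of `Λ` which is linearly independent over `ℝ`. -/
def IsZBasis {n : ℕ} {ι : Type*} (Λ : AddSubgroup (Fin n → ℝ)) (v : ι → Fin n → ℝ) : Prop :=
  LinearIndependent ℝ v ∧ Λ = AddSubgroup.closure (Set.range v)

section

variable {n : ℕ} {ι κ : Type*}

theorem linearIndependent_toLp {v : ι → Fin n → ℝ} (h : LinearIndependent ℝ v) :
    LinearIndependent ℝ fun i ↦ WithLp.toLp 2 (v i) :=
  h.map' (WithLp.linearEquiv 2 ℝ (Fin n → ℝ)).symm.toLinearMap (LinearEquiv.ker _)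

theorem IsZBasis.span_eq {Λ : AddSubgroup (Fin n → ℝ)} {v : ι → Fin n → ℝ} (h : IsZBasis Λ v) :
    Submodule.span ℝ (Λ : Set (Fin n → ℝ)) = Submodule.span ℝ (Set.range v) := by
  refine le_antisymm (Submodule.span_le.mpr fun x hx ↦ ?_) (Submodule.span_mono ?_)
  · have : Λ ≤ (Submodule.span ℝ (Set.range v)).toAddSubgroup := by
      rw [h.2, AddSubgroup.closure_le]; exact Submodule.subset_span
    exact this hx
  · rw [h.2]; exact AddSubgroup.subset_closure

theorem IsZBasis.comp_equiv {Λ : AddSubgroup (Fin n → ℝ)} {v : ι → Fin n → ℝ} (h : IsZBasis Λ v)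
    (e : κ ≃ ι) : IsZBasis Λ (v ∘ e) :=
  ⟨h.1.comp _ e.injective, by rw [EquivLike.range_comp]; exact h.2⟩

theorem toLp_sumElim (a : ι → Fin n → ℝ) (q : κ → Fin n → ℝ) :
    (fun i ↦ WithLp.toLp 2 (Sum.elim a q i)) =
      Sum.elim (fun i ↦ WithLp.toLp 2 (a i)) fun i ↦ WithLp.toLp 2 (q i) := by
  ext (i | i) <;> rfl

variable [Fintype ι] [Fintype κ]

/-- The `ℤ`-basis of `Λ` given by `IsZBasis Λ v`. -/
def IsZBasis.basis {Λ : AddSubgroup (Fin n → ℝ)} {v : ι → Fin n → ℝ} (h : IsZBasis Λ v) :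
    Module.Basis ι ℤ Λ.toIntSubmodule :=
  Module.Basis.mk (v := fun i ↦ ⟨v i, by
      rw [h.2]; exact AddSubgroup.subset_closure ⟨i, rfl⟩⟩)
    (LinearIndependent.of_comp Λ.toIntSubmodule.subtype (h.1.restrict_scalars' ℤ))
    (by
      rintro ⟨x, hx⟩ -
      have hx' : x ∈ Submodule.span ℤ (Set.range v) := by
        rw [← Submodule.mem_toAddSubgroup, Submodule.span_int_eq_addSubgroupClosure, ← h.2]
        exact hx
      obtain ⟨c, hc⟩ := (Submodule.mem_span_range_iff_exists_fun ℤ).mp hx'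
      refine (Submodule.mem_span_range_iff_exists_fun ℤ).mpr ⟨c, ?_⟩
      ext1
      simpa using hc)

theorem IsZBasis.basis_apply {Λ : AddSubgroup (Fin n → ℝ)} {v : ι → Fin n → ℝ} (h : IsZBasis Λ v)
    (i : ι) : (h.basis i : Fin n → ℝ) = v i := by
  simp [IsZBasis.basis]

theorem IsZBasis.rk_eq {Λ : AddSubgroup (Fin n → ℝ)} {v : ι → Fin n → ℝ} (h : IsZBasis Λ v) :
    rk Λ = Fintype.card ι := by
  rw [rk, h.span_eq, finrank_span_eq_card h.1]

variable [DecidableEq ι] [DecidableEq κ]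

theorem vol_pos {v : ι → Fin n → ℝ} (h : LinearIndependent ℝ v) : 0 < vol v :=
  Real.sqrt_pos.mpr (Matrix.posDef_gram_of_linearIndependent (linearIndependent_toLp h)).det_pos

theorem vol_comp_equiv (e : κ ≃ ι) (v : ι → Fin n → ℝ) : vol (v ∘ e) = vol v := by
  unfold vol
  rw [← Matrix.det_submatrix_equiv_self e]
  rfl

theorem vol_eq_abs_det_mul (v w : ι → Fin n → ℝ) (A : Matrix ι ι ℝ)
    (h : ∀ k, w k = ∑ i, A k i • v i) : vol w = |A.det| * vol v := by
  unfold vol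
  rw [gram_sum_smul (fun i ↦ WithLp.toLp 2 (v i)) _ A
    (fun k ↦ by rw [h k]; simp [WithLp.toLp_sum]), Matrix.det_mul, Matrix.det_mul,
    Matrix.det_transpose, mul_right_comm, Real.sqrt_mul (mul_self_nonneg _),
    Real.sqrt_mul_self_eq_abs]

theorem vol_sumElim_mul_le {ι' : Type*} [Fintype ι'] [DecidableEq ι'] (u : ι' → Fin n → ℝ)
    (v : ι → Fin n → ℝ) (q : κ → Fin n → ℝ) (huv : ∀ i, u i ∈ Submodule.span ℝ (Set.range v)) :
    vol (Sum.elim v q) * vol u ≤ vol v * vol (Sum.elim u q) := by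
  have h := det_gram_sumElim_mul_le (fun i ↦ WithLp.toLp 2 (u i)) (fun i ↦ WithLp.toLp 2 (v i))
    (fun i ↦ WithLp.toLp 2 (q i)) (fun i ↦ by
      have := Submodule.mem_map_of_mem (f := (WithLp.linearEquiv 2 ℝ (Fin n → ℝ)).symm.toLinearMap)
        (huv i)
      rw [Submodule.map_span, ← Set.range_comp] at this
      exact this)
  unfold vol
  rw [toLp_sumElim, toLp_sumElim, ← Real.sqrt_mul (Matrix.posSemidef_gram ℝ _).det_nonneg,
    ← Real.sqrt_mul (Matrix.posSemidef_gram ℝ _).det_nonneg]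
  exact Real.sqrt_le_sqrt h

theorem IsZBasis.vol_eq_relIndex_mul {Λ Λ' : AddSubgroup (Fin n → ℝ)} {v w : ι → Fin n → ℝ}
    (hw : IsZBasis Λ w) (hv : IsZBasis Λ' v) (hle : Λ ≤ Λ') :
    vol w = Λ.relIndex Λ' * vol v := by
  rw [AddSubgroup.relIndex_eq_natAbs_det Λ Λ' hle hw.basis hv.basis, Nat.cast_natAbs, Int.cast_abs]
  set f : ι → Λ'.toIntSubmodule := fun i ↦ ⟨hw.basis i, hle (SetLike.coe_mem _)⟩ with hf
  rw [vol_eq_abs_det_mul v w (((hv.basis.toMatrix f).map (Int.cast : ℤ → ℝ))ᵀ)]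
  · rw [Matrix.det_transpose, Module.Basis.det_apply]
    congr 2
    exact (RingHom.map_det (Int.castRingHom ℝ) _).symm
  · intro k
    have := congrArg Subtype.val (hv.basis.sum_repr (f k))
    simp only [AddSubmonoidClass.coe_finsetSum, SetLike.val_smul, hv.basis_apply] at this
    rw [← hw.basis_apply k]
    refine Eq.trans this.symm (Finset.sum_congr rfl fun i _ ↦ ?_)
    exact (Int.cast_smul_eq_zsmul ℝ _ _).symm

theorem IsZBasis.vol_eq_relIndex_mul_of_rk {Λ Λ' : AddSubgroup (Fin n → ℝ)} {w : κ → Fin n → ℝ}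
    {v : ι → Fin n → ℝ}
    (hw : IsZBasis Λ w) (hv : IsZBasis Λ' v) (hle : Λ ≤ Λ') (hrk : rk Λ = rk Λ') :
    vol w = Λ.relIndex Λ' * vol v := by
  rw [hw.rk_eq, hv.rk_eq] at hrk
  have e := Fintype.equivOfCardEq hrk
  rw [← vol_comp_equiv e v]
  exact hw.vol_eq_relIndex_mul (hv.comp_equiv e) hle

theorem IsZBasis.covol_eq {Λ : AddSubgroup (Fin n → ℝ)} {v : ι → Fin n → ℝ} (h : IsZBasis Λ v) :
    covol Λ = vol v := by
  have e := Fintype.equivFin ι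
  have : {c | covolSpec Λ c} = {vol v} := by
    ext c
    simp only [Set.mem_ofPred_eq, Set.mem_singleton_iff]
    constructor
    · rintro ⟨r, w, hw, hΛ, rfl⟩
      have hwb : IsZBasis Λ w := ⟨hw, hΛ⟩
      rw [gvol_eq_vol, hwb.vol_eq_relIndex_mul_of_rk h le_rfl rfl]
      simp
    · rintro rfl
      have := h.comp_equiv e.symm
      exact ⟨_, _, this.1, this.2, by rw [gvol_eq_vol, vol_comp_equiv]⟩
  rw [covol, this, csInf_singleton]

end

section

variable {n : ℕ}

theorem linearIndependent_real_of_int {ι : Type*} [Fintype ι] {v : ι → Fin n → ℝ}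
    (hd : DiscreteTopology (AddSubgroup.closure (Set.range v))) (h : LinearIndependent ℤ v) :
    LinearIndependent ℝ v := by
  rw [← Submodule.span_int_eq_addSubgroupClosure] at hd
  rw [linearIndependent_iff_card_eq_finrank_span,
    Real.finrank_eq_int_finrank_of_discrete (s := Set.range v) hd]
  exact linearIndependent_iff_card_eq_finrank_span.mp h

theorem discreteTopology_of_le {Λ L : AddSubgroup (Fin n → ℝ)} [DiscreteTopology L] (h : Λ ≤ L) :
    DiscreteTopology Λ :=
  DiscreteTopology.of_subset (s := (L : Set (Fin n → ℝ))) ‹_› h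

theorem exists_isZBasis (Λ : AddSubgroup (Fin n → ℝ)) [hd : DiscreteTopology Λ] :
    ∃ (r : ℕ) (v : Fin r → Fin n → ℝ), IsZBasis Λ v := by
  have : DiscreteTopology Λ.toIntSubmodule := hd
  let b := Module.finBasis ℤ Λ.toIntSubmodule
  let v := fun i ↦ (b i : Fin n → ℝ)
  have hspan : Λ = AddSubgroup.closure (Set.range v) := by
    rw [← Submodule.span_int_eq_addSubgroupClosure]
    have : Submodule.span ℤ (Set.range v) = Λ.toIntSubmodule := by
      have h := congrArg (Submodule.map Λ.toIntSubmodule.subtype) b.span_eq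
      rw [Submodule.map_span, ← Set.range_comp, Submodule.map_subtype_top] at h
      exact h
    rw [this]; simp
  refine ⟨_, v, linearIndependent_real_of_int (hspan ▸ hd) ?_, hspan⟩
  exact b.linearIndependent.map' Λ.toIntSubmodule.subtype (Submodule.ker_subtype _)

theorem covol_pos (Λ : AddSubgroup (Fin n → ℝ)) [DiscreteTopology Λ] : 0 < covol Λ := by
  obtain ⟨r, v, hv⟩ := exists_isZBasis Λ
  rw [hv.covol_eq]
  exact vol_pos hv.1

theorem covol_eq_relIndex_mul {Λ Λ' : AddSubgroup (Fin n → ℝ)} [DiscreteTopology Λ']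
    (hle : Λ ≤ Λ') (hrk : rk Λ = rk Λ') : covol Λ = Λ.relIndex Λ' * covol Λ' := by
  have := discreteTopology_of_le hle
  obtain ⟨r, v, hv⟩ := exists_isZBasis Λ
  obtain ⟨r', v', hv'⟩ := exists_isZBasis Λ'
  rw [hv.covol_eq, hv'.covol_eq]
  exact hv.vol_eq_relIndex_mul_of_rk hv' hle hrk

theorem relIndex_ne_zero_of_rk {Λ Λ' : AddSubgroup (Fin n → ℝ)} [DiscreteTopology Λ']
    (hle : Λ ≤ Λ') (hrk : rk Λ = rk Λ') : Λ.relIndex Λ' ≠ 0 := fun h ↦ by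
  have := discreteTopology_of_le hle
  have h1 := covol_eq_relIndex_mul hle hrk
  rw [h] at h1
  have := covol_pos Λ
  simp at h1
  linarith

theorem covol_le_of_le_of_rk {Λ Λ' : AddSubgroup (Fin n → ℝ)} [DiscreteTopology Λ']
    (hle : Λ ≤ Λ') (hrk : rk Λ = rk Λ') : covol Λ' ≤ covol Λ := by
  rw [covol_eq_relIndex_mul hle hrk]
  have h1 : (1 : ℝ) ≤ Λ.relIndex Λ' := by
    exact_mod_cast Nat.one_le_iff_ne_zero.mpr (relIndex_ne_zero_of_rk hle hrk)
  nlinarith [covol_pos Λ']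

theorem rk_mono {Λ Λ' : AddSubgroup (Fin n → ℝ)} (hle : Λ ≤ Λ') : rk Λ ≤ rk Λ' :=
  Submodule.finrank_mono (Submodule.span_mono hle)

theorem rk_le (Λ : AddSubgroup (Fin n → ℝ)) : rk Λ ≤ n := by
  simpa using! Submodule.finrank_le (Submodule.span ℝ (Λ : Set (Fin n → ℝ)))

theorem rk_eq_zero {Λ : AddSubgroup (Fin n → ℝ)} : rk Λ = 0 ↔ Λ = ⊥ := by
  rw [rk, Submodule.finrank_eq_zero, Submodule.span_eq_bot]
  exact (AddSubgroup.eq_bot_iff_forall Λ).symm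

theorem covol_bot : covol (⊥ : AddSubgroup (Fin n → ℝ)) = 1 := by
  have : IsZBasis (⊥ : AddSubgroup (Fin n → ℝ)) (Fin.elim0 : Fin 0 → Fin n → ℝ) :=
    ⟨linearIndependent_empty_type, by simp⟩
  rw [this.covol_eq]
  simp [vol]

/-- Vectors of `Λ` whose classes modulo `W` form a `ℤ`-basis of the image of `Λ`. -/
theorem exists_lift_basis_mod (Λ : AddSubgroup (Fin n → ℝ)) [hd : DiscreteTopology Λ]
    (W : Submodule ℝ (Fin n → ℝ)) :
    ∃ (m : ℕ) (q : Fin m → Fin n → ℝ),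
      LinearIndependent ℤ (Submodule.Quotient.mk (p := W.restrictScalars ℤ) ∘ q) ∧
      Λ = (Λ ⊓ W.toAddSubgroup) ⊔ AddSubgroup.closure (Set.range q) := by
  have : DiscreteTopology Λ.toIntSubmodule := hd
  let f : (Fin n → ℝ) →ₗ[ℤ] ((Fin n → ℝ) ⧸ W) := W.mkQ.restrictScalars ℤ
  let M := Λ.toIntSubmodule.map f
  have : Module.Finite ℤ M := Module.Finite.map _ _
  have : Module ℚ ((Fin n → ℝ) ⧸ W) := Module.compHom _ (algebraMap ℚ ℝ)
  have : IsAddTorsionFree ((Fin n → ℝ) ⧸ W) := .of_module_rat _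
  have : Module.Free ℤ M := inferInstance
  let b := Module.finBasis ℤ M
  have hb : ∀ j, ∃ x ∈ Λ, f x = b j := fun j ↦ by
    obtain ⟨x, hx, h⟩ := (b j).2
    exact ⟨x, hx, h⟩
  choose q hqΛ hq using hb
  refine ⟨_, q, ?_, le_antisymm (fun x hx ↦ ?_) (sup_le inf_le_left ?_)⟩
  · have h1 : LinearIndependent ℤ (fun j ↦ f (q j)) := by
      simp_rw [hq]
      exact b.linearIndependent.map' M.subtype (Submodule.ker_subtype _)
    exact h1.map' (Submodule.Quotient.restrictScalarsEquiv ℤ W).symm.toLinearMap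
      (LinearEquiv.ker _)
  · have hsum := congrArg Subtype.val (b.sum_repr ⟨f x, x, hx, rfl⟩)
    set c := b.repr ⟨f x, x, hx, rfl⟩
    have hy : ∑ j, c j • q j ∈ AddSubgroup.closure (Set.range q) :=
      sum_mem fun j _ ↦ zsmul_mem (AddSubgroup.subset_closure (Set.mem_range_self j)) _
    have hyΛ : ∑ j, c j • q j ∈ Λ := sum_mem fun j _ ↦ zsmul_mem (hqΛ j) _
    have h0 : f (x - ∑ j, c j • q j) = 0 := by
      have h1 : f x = ∑ j, c j • (b j : (Fin n → ℝ) ⧸ W) := by simpa using hsum.symm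
      rw [map_sub, map_sum, sub_eq_zero, h1]
      simp only [map_zsmul, hq]
    have hW : x - ∑ j, c j • q j ∈ W := (Submodule.Quotient.mk_eq_zero W).mp h0
    have hmem : x - ∑ j, c j • q j ∈ Λ ⊓ W.toAddSubgroup := ⟨Λ.sub_mem hx hyΛ, hW⟩
    exact AddSubgroup.mem_sup.mpr ⟨_, hmem, _, hy, sub_add_cancel _ _⟩
  · rw [AddSubgroup.closure_le]
    rintro _ ⟨j, rfl⟩
    exact hqΛ j

theorem IsZBasis.sumElim {Λ L : AddSubgroup (Fin n → ℝ)} [DiscreteTopology L]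
    {W : Submodule ℝ (Fin n → ℝ)} {ι κ : Type*} [Fintype ι] [Fintype κ] {v : ι → Fin n → ℝ}
    {q : κ → Fin n → ℝ} (hv : IsZBasis Λ v) (hW : Λ ≤ W.toAddSubgroup)
    (hq : LinearIndependent ℤ (Submodule.Quotient.mk (p := W.restrictScalars ℤ) ∘ q))
    (hL : L = Λ ⊔ AddSubgroup.closure (Set.range q)) : IsZBasis L (Sum.elim v q) := by
  have hL' : L = AddSubgroup.closure (Set.range (Sum.elim v q)) := by
    rw [Set.Sum.elim_range, AddSubgroup.closure_union, ← hv.2, hL]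
  refine ⟨linearIndependent_real_of_int (hL' ▸ ‹_›) ?_, hL'⟩
  have hmem : ∀ i, v i ∈ W.restrictScalars ℤ := fun i ↦ hW <| by
    rw [hv.2]; exact AddSubgroup.subset_closure ⟨i, rfl⟩
  refine LinearIndependent.sumElim_of_quotient (f := fun i ↦ ⟨v i, hmem i⟩) ?_ q hq
  exact LinearIndependent.of_comp (W.restrictScalars ℤ).subtype (hv.1.restrict_scalars' ℤ)

/-- Submodularity of the logarithm of the covolume, and modularity of the rank. -/
theorem covol_sup_mul_covol_inf_le (Λ₁ Λ₂ : AddSubgroup (Fin n → ℝ))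
    [DiscreteTopology (Λ₁ ⊔ Λ₂ : AddSubgroup (Fin n → ℝ))] :
    covol (Λ₁ ⊔ Λ₂) * covol (Λ₁ ⊓ Λ₂) ≤ covol Λ₁ * covol Λ₂ ∧
      rk (Λ₁ ⊔ Λ₂) + rk (Λ₁ ⊓ Λ₂) = rk Λ₁ + rk Λ₂ := by
  set W := Submodule.span ℝ (Λ₁ : Set (Fin n → ℝ))
  have hΛW : Λ₁ ≤ W.toAddSubgroup := Submodule.subset_span
  have : DiscreteTopology Λ₂ := discreteTopology_of_le (le_sup_right : Λ₂ ≤ Λ₁ ⊔ Λ₂)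
  obtain ⟨m, q, hq, hΛ₂⟩ := exists_lift_basis_mod Λ₂ W
  set D := Λ₂ ⊓ W.toAddSubgroup with hD
  set S := D ⊔ Λ₁ with hS
  set Q := AddSubgroup.closure (Set.range q)
  have hDΛ₂ : D ≤ Λ₂ := inf_le_left
  have : DiscreteTopology D := discreteTopology_of_le hDΛ₂
  have : DiscreteTopology S :=
    discreteTopology_of_le (sup_le (hDΛ₂.trans le_sup_right) le_sup_left : S ≤ Λ₁ ⊔ Λ₂)
  obtain ⟨t, d, hd⟩ := exists_isZBasis D
  obtain ⟨p, s, hs⟩ := exists_isZBasis S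
  have hSW : S ≤ W.toAddSubgroup := sup_le inf_le_right hΛW
  have hb₂ : IsZBasis Λ₂ (Sum.elim d q) := hd.sumElim inf_le_right hq hΛ₂
  have hb : IsZBasis (Λ₁ ⊔ Λ₂) (Sum.elim s q) := hs.sumElim hSW hq (by
    conv_lhs => rw [hΛ₂]
    rw [← sup_assoc, hS, sup_comm D])
  have hvol := vol_sumElim_mul_le d s q fun i ↦ by
    rw [← hs.span_eq]
    refine Submodule.subset_span ((le_sup_left : D ≤ S) ?_)
    rw [hd.2]; exact AddSubgroup.subset_closure ⟨i, rfl⟩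
  rw [← hb.covol_eq, ← hb₂.covol_eq, ← hd.covol_eq, ← hs.covol_eq] at hvol
  have hrk₁ : rk Λ₁ = rk S := le_antisymm (rk_mono le_sup_right)
    (Submodule.finrank_mono (Submodule.span_le.mpr hSW))
  have hc₁ := covol_eq_relIndex_mul (le_sup_right : Λ₁ ≤ S) hrk₁
  have hk := relIndex_ne_zero_of_rk (le_sup_right : Λ₁ ≤ S) hrk₁
  have hinf : Λ₁ ⊓ Λ₂ = Λ₁ ⊓ D := by
    rw [hD, ← inf_assoc]
    exact (inf_eq_left.mpr (inf_le_left.trans hΛW)).symm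
  have hidx : (Λ₁ ⊓ Λ₂).relIndex D = Λ₁.relIndex S := by
    rw [hinf, AddSubgroup.inf_relIndex_right, hS, AddSubgroup.relIndex_sup_right]
  have hle : Λ₁ ⊓ Λ₂ ≤ D := hinf ▸ inf_le_right
  have hrk : rk (Λ₁ ⊓ Λ₂) = rk D := by
    refine le_antisymm (rk_mono hle) (Submodule.finrank_mono (Submodule.span_le.mpr fun x hx ↦ ?_))
    have h1 : (Λ₁ ⊓ Λ₂).relIndex D • x ∈ Λ₁ ⊓ Λ₂ := AddSubgroup.nsmul_relIndex_mem _ hx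
    rw [hidx] at h1
    have h2 := Submodule.smul_mem _ ((Λ₁.relIndex S : ℝ)⁻¹) (Submodule.subset_span (R := ℝ) h1)
    rwa [← Nat.cast_smul_eq_nsmul ℝ, inv_smul_smul₀ (by exact_mod_cast hk)] at h2
  have hc := covol_eq_relIndex_mul hle hrk
  rw [hidx] at hc
  constructor
  · rw [hc, hc₁]
    have : (0 : ℝ) ≤ Λ₁.relIndex S := Nat.cast_nonneg _
    nlinarith
  · rw [hrk, hrk₁, hb.rk_eq, hd.rk_eq, hs.rk_eq, hb₂.rk_eq]
    simp only [Fintype.card_sum]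
    ring

theorem covol_nonneg (Λ : AddSubgroup (Fin n → ℝ)) : 0 ≤ covol Λ :=
  Real.sInf_nonneg <| by
    rintro _ ⟨r, v, -, -, rfl⟩
    exact Real.sqrt_nonneg _

theorem alpha_nonneg (L : AddSubgroup (Fin n → ℝ)) : 0 ≤ alpha L :=
  Real.sInf_nonneg <| by
    rintro _ ⟨Λ, -, -, rfl⟩
    exact Real.rpow_nonneg (covol_nonneg Λ) _

theorem alpha_le {Λ L : AddSubgroup (Fin n → ℝ)} (hle : Λ ≤ L) (h0 : Λ ≠ ⊥) :
    alpha L ≤ covol Λ ^ ((rk Λ : ℝ)⁻¹) := by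
  refine csInf_le ⟨0, ?_⟩ ⟨Λ, hle, h0, rfl⟩
  rintro _ ⟨Λ, -, -, rfl⟩
  exact Real.rpow_nonneg (covol_nonneg Λ) _

theorem alpha_pow_rk_le {Λ L : AddSubgroup (Fin n → ℝ)} (hle : Λ ≤ L) :
    alpha L ^ rk Λ ≤ covol Λ := by
  by_cases h0 : Λ = ⊥
  · rw [rk_eq_zero.mpr h0, h0, covol_bot, pow_zero]
  · have h := pow_le_pow_left₀ (alpha_nonneg L) (alpha_le hle h0) (rk Λ)
    rwa [Real.rpow_inv_natCast_pow (covol_nonneg Λ) (mt rk_eq_zero.mp h0)] at h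

theorem covol_rpow_lt_iff {Λ : AddSubgroup (Fin n → ℝ)} (h0 : Λ ≠ ⊥) {c : ℝ} (hc : 0 ≤ c) :
    covol Λ ^ ((rk Λ : ℝ)⁻¹) < c ↔ covol Λ < c ^ rk Λ := by
  have hr := mt rk_eq_zero.mp h0
  rw [← pow_lt_pow_iff_left₀ (Real.rpow_nonneg (covol_nonneg Λ) _) hc hr,
    Real.rpow_inv_natCast_pow (covol_nonneg Λ) hr]

theorem alpha_pos_of_mem_minSet {δ : ℝ} (hδ : 0 < δ) {Λ L : AddSubgroup (Fin n → ℝ)}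
    (h : Λ ∈ MinSet δ L) : 0 < alpha L := by
  have h1 := (Real.rpow_nonneg (covol_nonneg Λ) _).trans_lt h.2.2
  exact pos_of_mul_pos_right h1 (by linarith)

/-- A weakening of membership in `MinSet δ L`, with a loss depending on the rank, which is
preserved by adding members of `MinSet δ L`. -/
def RankMin (δ : ℝ) (L Λ : AddSubgroup (Fin n → ℝ)) : Prop :=
  Λ ≤ L ∧ Λ ≠ ⊥ ∧ covol Λ < ((1 + δ) ^ rk Λ * alpha L) ^ rk Λ

theorem rankMin_of_mem_minSet {δ : ℝ} (hδ : 0 < δ) {Λ L : AddSubgroup (Fin n → ℝ)}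
    (h : Λ ∈ MinSet δ L) : RankMin δ L Λ := by
  obtain ⟨hle, h0, hlt⟩ := h
  have hα := alpha_nonneg L
  rw [covol_rpow_lt_iff h0 (by positivity)] at hlt
  refine ⟨hle, h0, hlt.trans_le ?_⟩
  gcongr
  exact le_self_pow₀ (by linarith) (mt rk_eq_zero.mp h0)

theorem RankMin.mem_minSet {δ : ℝ} (hδ : 0 < δ) {L Λ : AddSubgroup (Fin n → ℝ)}
    (h : RankMin δ L Λ) : Λ ∈ MinSet ((1 + δ) ^ n - 1) L := by
  obtain ⟨hle, h0, hlt⟩ := h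
  have hα := alpha_nonneg L
  refine ⟨hle, h0, ?_⟩
  rw [add_sub_cancel, covol_rpow_lt_iff h0 (by positivity)]
  refine hlt.trans_le ?_
  gcongr
  · linarith
  · exact rk_le Λ

theorem RankMin.sup {δ : ℝ} (hδ : 0 < δ) {L Λ Λ' : AddSubgroup (Fin n → ℝ)}
    [DiscreteTopology L] (h : RankMin δ L Λ) (h' : Λ' ∈ MinSet δ L) : RankMin δ L (Λ ⊔ Λ') := by
  have hα := alpha_pos_of_mem_minSet hδ h'
  obtain ⟨hle, h0, hlt⟩ := h
  obtain ⟨hle', h0', hlt'⟩ := h'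
  have hsup : Λ ⊔ Λ' ≤ L := sup_le hle hle'
  have := discreteTopology_of_le hsup
  refine ⟨hsup, fun h ↦ h0 (sup_eq_bot_iff.mp h).1, ?_⟩
  obtain hrk | hrk := (rk_mono (le_sup_left : Λ ≤ Λ ⊔ Λ')).eq_or_lt
  · rw [← hrk]
    exact (covol_le_of_le_of_rk le_sup_left hrk).trans_lt hlt
  have hrk' : rk Λ' ≤ rk (Λ ⊔ Λ') := rk_mono le_sup_right
  obtain ⟨hmul, hadd⟩ := covol_sup_mul_covol_inf_le Λ Λ'
  rw [covol_rpow_lt_iff h0' (by positivity)] at hlt'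
  have hinf := alpha_pow_rk_le (inf_le_left.trans hle : Λ ⊓ Λ' ≤ L)
  refine lt_of_mul_lt_mul_right ?_ (pow_nonneg hα.le (rk (Λ ⊓ Λ')))
  calc covol (Λ ⊔ Λ') * alpha L ^ rk (Λ ⊓ Λ')
      ≤ covol (Λ ⊔ Λ') * covol (Λ ⊓ Λ') := by gcongr; exact covol_nonneg _
    _ ≤ covol Λ * covol Λ' := hmul
    _ < ((1 + δ) ^ rk Λ * alpha L) ^ rk Λ * ((1 + δ) * alpha L) ^ rk Λ' :=
        mul_lt_mul'' hlt hlt' (covol_nonneg _) (covol_nonneg _)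
    _ = (1 + δ) ^ (rk Λ * rk Λ + rk Λ') * alpha L ^ (rk Λ + rk Λ') := by
        rw [mul_pow, mul_pow, ← pow_mul, pow_add, pow_add]; ring
    _ ≤ (1 + δ) ^ (rk (Λ ⊔ Λ') * rk (Λ ⊔ Λ')) * alpha L ^ (rk Λ + rk Λ') := by
        gcongr
        · linarith
        · nlinarith
    _ = ((1 + δ) ^ rk (Λ ⊔ Λ') * alpha L) ^ rk (Λ ⊔ Λ') * alpha L ^ rk (Λ ⊓ Λ') := by
        rw [← hadd, mul_pow, ← pow_mul, pow_add, mul_assoc]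

theorem rankMin_iSup {δ : ℝ} (hδ : 0 < δ) {L : AddSubgroup (Fin n → ℝ)} [DiscreteTopology L]
    {ι : Type*} [Fintype ι] [Nonempty ι] {Λ : ι → AddSubgroup (Fin n → ℝ)}
    (h : ∀ i, Λ i ∈ MinSet δ L) : RankMin δ L (⨆ i, Λ i) := by
  rw [← Finset.sup_univ_eq_iSup]
  generalize hs : (Finset.univ : Finset ι) = s
  have hne : s.Nonempty := hs ▸ Finset.univ_nonempty
  clear hs
  induction hne using Finset.Nonempty.cons_induction with
  | singleton i =>
    rw [Finset.sup_singleton]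
    exact rankMin_of_mem_minSet hδ (h i)
  | cons i s hi _ ih =>
    rw [Finset.sup_cons, sup_comm]
    exact ih.sup hδ (h i)

theorem exists_rankMin_Vdelta_le {δ : ℝ} (hδ : 0 < δ) {L : AddSubgroup (Fin n → ℝ)}
    [DiscreteTopology L] (hne : (MinSet δ L).Nonempty) :
    ∃ Λ, RankMin δ L Λ ∧ Vdelta δ L ≤ Submodule.span ℝ (Λ : Set (Fin n → ℝ)) := by
  have hfin : (rk '' {Λ | RankMin δ L Λ}).Finite :=
    (Set.finite_Iic n).subset (by rintro _ ⟨Λ, -, rfl⟩; exact rk_le Λ)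
  obtain ⟨Λ₀, h₀⟩ := hne
  obtain ⟨Λ, hΛ, hmax⟩ := Set.exists_max_image _ id hfin ⟨_, Λ₀, rankMin_of_mem_minSet hδ h₀, rfl⟩
  obtain ⟨Λ, hΛ, rfl⟩ := hΛ
  refine ⟨Λ, hΛ, Submodule.span_le.mpr (Set.iUnion₂_subset fun Λ' h' ↦ ?_)⟩
  have hle : Submodule.span ℝ (Λ : Set (Fin n → ℝ)) ≤
      Submodule.span ℝ ((Λ ⊔ Λ' : AddSubgroup (Fin n → ℝ)) : Set (Fin n → ℝ)) :=
    Submodule.span_mono (SetLike.coe_subset_coe.mpr le_sup_left)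
  rw [Submodule.eq_of_le_of_finrank_le hle (hmax _ ⟨_, hΛ.sup hδ h', rfl⟩)]
  exact (SetLike.coe_subset_coe.mpr (le_sup_right : Λ' ≤ Λ ⊔ Λ')).trans Submodule.subset_span

theorem inv_le_alpha_of_dimdelta_eq (hn : 0 < n) {δ : ℝ} (hδ : 0 < δ)
    {L : AddSubgroup (Fin n → ℝ)} (hL : IsUnimodularLattice L) (hdim : dimdelta δ L = n) :
    ((1 + δ) ^ n)⁻¹ ≤ alpha L := by
  obtain ⟨⟨hd, hspan⟩, hcov⟩ := hL
  have hne : (MinSet δ L).Nonempty := by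
    refine Set.nonempty_iff_ne_empty.mpr fun h ↦ ?_
    have hV : Vdelta δ L = ⊥ := by simp [Vdelta, h]
    rw [dimdelta, hV, finrank_bot] at hdim
    exact hn.ne hdim
  obtain ⟨Λ, ⟨hle, h0, hlt⟩, hV⟩ := exists_rankMin_Vdelta_le hδ hne
  have hrk : rk Λ = n := (rk_le Λ).antisymm (hdim.symm.le.trans (Submodule.finrank_mono hV))
  have hrkL : rk L = n := (rk_le L).antisymm (hrk.symm.le.trans (rk_mono hle))
  have h1 := (covol_le_of_le_of_rk hle (hrk.trans hrkL.symm)).trans_lt hlt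
  rw [hcov, hrk, one_lt_pow_iff_of_nonneg (mul_nonneg (by positivity) (alpha_nonneg L)) hn.ne']
    at h1
  rw [inv_le_iff_one_le_mul₀' (by positivity)]
  exact h1.le

end

end SW

/-- **Lemma 2.8.** There is `ψ : (0,∞) → (0,∞)` with `ψ(δ) → 0` as `δ → 0⁺` such that for any
`x ∈ ℒ_n` and `Λ₁, …, Λ_ℓ ∈ Min_δ(x)` one has `Λ₁ + ⋯ + Λ_ℓ ∈ Min_{ψ(δ)}(x)`; in particular
`dim_δ(x) = n` implies `α(x) ≥ (1 + ψ(δ))⁻¹`. -/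
theorem SW.sum_of_minimal_subgroups (n : ℕ) (hn : 0 < n) :
    ∃ ψ : ℝ → ℝ, (∀ δ : ℝ, 0 < δ → 0 < ψ δ) ∧
      Filter.Tendsto ψ (𝓝[>] (0 : ℝ)) (𝓝 0) ∧
      ∀ L : AddSubgroup (Fin n → ℝ), SW.IsUnimodularLattice L → ∀ δ : ℝ, 0 < δ →
        (∀ ℓ : ℕ, 0 < ℓ → ∀ Λ : Fin ℓ → AddSubgroup (Fin n → ℝ),
          (∀ i, Λ i ∈ SW.MinSet δ L) → (⨆ i, Λ i) ∈ SW.MinSet (ψ δ) L) ∧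
        (SW.dimdelta δ L = n → (1 + ψ δ)⁻¹ ≤ SW.alpha L) := by
  refine ⟨fun δ ↦ (1 + δ) ^ n - 1, fun δ hδ ↦ ?_, ?_, fun L hL δ hδ ↦
    ⟨fun ℓ hℓ Λ h ↦ ?_, fun h ↦ ?_⟩⟩
  · exact sub_pos.mpr (one_lt_pow₀ (by linarith) hn.ne')
  · have : Continuous fun δ : ℝ ↦ (1 + δ) ^ n - 1 := by fun_prop
    simpa using (this.tendsto 0).mono_left nhdsWithin_le_nhds
  · have := hL.1.1
    have : Nonempty (Fin ℓ) := ⟨⟨0, hℓ⟩⟩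
    exact (SW.rankMin_iSup hδ h).mem_minSet hδ
  · simpa using SW.inv_le_alpha_of_dimdelta_eq hn hδ hL h
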